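/- Let Ω ⊆ ℝ^d be open and let ρ : Ω → (0,∞) be C³. Set v = ∇(log ρ). Then at every point of Ω and for every component i: Σ_j ∂_j ( ρ ∂_j v_i ) = 2 ρ ∂_i ( Δ√ρ / √ρ ), i.e. div(ρ ∇v) = 2 ρ ∇( Δ√ρ / √ρ ) (the Bohm identity). -/

import Mathlib

noncomputable section

abbrev Vec (d : ℕ) := Fin d → ℝ

/-- Spatial partial derivative in direction `i`. -/
noncomputable def pd {d : ℕ} (i : Fin d) (f : Vec d → ℝ) (x : Vec d) : ℝ :=
  fderiv ℝ f x (Pi.single i 1)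

section

variable {d : ℕ} {Ω : Set (Vec d)} {f g : Vec d → ℝ} {x : Vec d}

theorem pd_congr (hΩ : IsOpen Ω) (h : Set.EqOn f g Ω) (hx : x ∈ Ω) (i : Fin d) :
    pd i f x = pd i g x := by
  simp only [pd, (h.eventuallyEq_of_mem (hΩ.mem_nhds hx)).fderiv_eq]

theorem contDiffOn_pd {n m : WithTop ℕ∞} (hΩ : IsOpen Ω) (hf : ContDiffOn ℝ n f Ω)
    (hmn : m + 1 ≤ n) (i : Fin d) : ContDiffOn ℝ m (pd i f) Ω :=
  (hf.fderiv_of_isOpen hΩ hmn).clm_apply contDiffOn_const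

theorem pd_mul (hf : DifferentiableAt ℝ f x) (hg : DifferentiableAt ℝ g x) (i : Fin d) :
    pd i (fun y => f y * g y) x = pd i f x * g x + f x * pd i g x := by
  simp only [pd, fderiv_fun_mul hf hg, add_apply, smul_apply, smul_eq_mul]
  ring

theorem pd_add (hf : DifferentiableAt ℝ f x) (hg : DifferentiableAt ℝ g x) (i : Fin d) :
    pd i (fun y => f y + g y) x = pd i f x + pd i g x := by
  simp only [pd, fderiv_fun_add hf hg, add_apply]

theorem pd_sum {ι : Type*} {s : Finset ι} {F : ι → Vec d → ℝ}
    (hF : ∀ j ∈ s, DifferentiableAt ℝ (F j) x) (i : Fin d) :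
    pd i (fun y => ∑ j ∈ s, F j y) x = ∑ j ∈ s, pd i (F j) x := by
  simp only [pd, fderiv_fun_sum hF, sum_apply]

theorem pd_const_mul (hf : DifferentiableAt ℝ f x) (c : ℝ) (i : Fin d) :
    pd i (fun y => c * f y) x = c * pd i f x := by
  simp only [pd, fderiv_const_mul hf, smul_apply, smul_eq_mul]

theorem pd_exp (hf : DifferentiableAt ℝ f x) (i : Fin d) :
    pd i (fun y => Real.exp (f y)) x = Real.exp (f x) * pd i f x := by
  simp only [pd, fderiv_exp hf, smul_apply, smul_eq_mul]

theorem pd_comm (hΩ : IsOpen Ω) (hf : ContDiffOn ℝ 2 f Ω) (hx : x ∈ Ω) (i j : Fin d) :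
    pd i (pd j f) x = pd j (pd i f) x := by
  have hfx : ContDiffAt ℝ 2 f x := hf.contDiffAt (hΩ.mem_nhds hx)
  have hd : DifferentiableAt ℝ (fderiv ℝ f) x :=
    (hfx.fderiv_right (m := 1) (by norm_num)).differentiableAt one_ne_zero
  have key (k l : Fin d) : pd k (pd l f) x
      = fderiv ℝ (fderiv ℝ f) x (Pi.single k 1) (Pi.single l 1) := by
    change fderiv ℝ (fun y => fderiv ℝ f y (Pi.single l 1)) x (Pi.single k 1) = _
    rw [fderiv_clm_apply hd (differentiableAt_const _)]
    simp
  rw [key, key]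
  exact hfx.isSymmSndFDerivAt (by simp) _ _

/-- The second derivative of `√ρ = exp (u / 2)` in terms of `u = log ρ`. -/
theorem pd_pd_exp_half (hΩ : IsOpen Ω) (hf : ContDiffOn ℝ 2 f Ω) (hx : x ∈ Ω) (j : Fin d) :
    pd j (pd j (fun y => Real.exp (1 / 2 * f y))) x
      = Real.exp (1 / 2 * f x) * (1 / 4 * (pd j f x * pd j f x) + 1 / 2 * pd j (pd j f) x) := by
  have hd : ∀ y ∈ Ω, DifferentiableAt ℝ f y := fun y hy =>
    (hf.contDiffAt (hΩ.mem_nhds hy)).differentiableAt two_ne_zero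
  have hd' : DifferentiableAt ℝ (pd j f) x :=
    ((contDiffOn_pd hΩ hf (m := 1) (by norm_num) j).contDiffAt
      (hΩ.mem_nhds hx)).differentiableAt one_ne_zero
  have first : ∀ y ∈ Ω, pd j (fun y => Real.exp (1 / 2 * f y)) y
      = Real.exp (1 / 2 * f y) * (1 / 2 * pd j f y) := fun y hy => by
    rw [pd_exp ((hd y hy).const_mul _), pd_const_mul (hd y hy)]
  rw [pd_congr hΩ first hx, pd_mul ((hd x hx).const_mul _).exp (hd'.const_mul _),
    first x hx, pd_const_mul hd']
  ring

end

/-- The Bohm identity: for `v = ∇ log ρ` one has, componentwise on an open set `Ω`,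
`div(ρ∇v) = 2 ρ ∇(Δ√ρ/√ρ)`. -/
theorem bohm_identity (d : ℕ) (Ω : Set (Vec d)) (hΩ : IsOpen Ω)
    (ρ : Vec d → ℝ) (hρ : ContDiffOn ℝ 3 ρ Ω) (hρpos : ∀ x ∈ Ω, 0 < ρ x)
    (v : Vec d → Vec d)
    (hv : ∀ x ∈ Ω, ∀ i, v x i = pd i (fun y => Real.log (ρ y)) x) :
    ∀ x ∈ Ω, ∀ i : Fin d,
      (∑ j, pd j (fun y => ρ y * pd j (fun z => v z i) y) x)
        = 2 * ρ x * pd i (fun y =>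
            (∑ j, pd j (fun z => pd j (fun w => Real.sqrt (ρ w)) z) y)
              / Real.sqrt (ρ y)) x := by
  intro x hx i
  set u : Vec d → ℝ := fun y => Real.log (ρ y)
  have hu : ContDiffOn ℝ 3 u Ω := hρ.log fun y hy => (hρpos y hy).ne'
  have hu2 : ContDiffOn ℝ 2 u Ω := hu.of_le (by norm_num)
  have hu' (j : Fin d) : ContDiffOn ℝ 2 (pd j u) Ω := contDiffOn_pd hΩ hu (by norm_num) j
  have hu'' (j k : Fin d) : ContDiffOn ℝ 1 (pd k (pd j u)) Ω :=
    contDiffOn_pd hΩ (hu' j) (by norm_num) k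
  have du : DifferentiableAt ℝ u x :=
    (hu.contDiffAt (hΩ.mem_nhds hx)).differentiableAt three_ne_zero
  have du' (j : Fin d) : DifferentiableAt ℝ (pd j u) x :=
    ((hu' j).contDiffAt (hΩ.mem_nhds hx)).differentiableAt two_ne_zero
  have du'' (j k : Fin d) : DifferentiableAt ℝ (pd k (pd j u)) x :=
    ((hu'' j k).contDiffAt (hΩ.mem_nhds hx)).differentiableAt one_ne_zero
  have ρ_eq : ∀ y ∈ Ω, ρ y = Real.exp (u y) := fun y hy => (Real.exp_log (hρpos y hy)).symm
  have sqrt_eq : ∀ y ∈ Ω, √(ρ y) = Real.exp (1 / 2 * u y) := fun y hy => by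
    rw [ρ_eq y hy, one_div_mul_eq_div, Real.exp_half]
  have lhs (j : Fin d) : pd j (fun y => ρ y * pd j (fun z => v z i) y) x
      = ρ x * (pd j u x * pd i (pd j u) x + pd i (pd j (pd j u)) x) := by
    have flux : Set.EqOn (fun y => ρ y * pd j (fun z => v z i) y)
        (fun y => Real.exp (u y) * pd i (pd j u) y) Ω := fun y hy => by
      change ρ y * _ = _
      rw [pd_congr hΩ (fun z hz => hv z hz i) hy, ρ_eq y hy]
      exact congrArg _ (pd_comm hΩ hu2 hy j i)
    rw [pd_congr hΩ flux hx, pd_mul du.exp (du'' j i), pd_exp du, ρ_eq x hx,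
      pd_comm hΩ (hu' j) hx j i]
    ring
  have quotient : Set.EqOn
      (fun y => (∑ j, pd j (fun z => pd j (fun w => √(ρ w)) z) y) / √(ρ y))
      (fun y => ∑ j, (1 / 4 * (pd j u y * pd j u y) + 1 / 2 * pd j (pd j u) y)) Ω :=
    fun y hy => by
      have second (j : Fin d) : pd j (fun z => pd j (fun w => √(ρ w)) z) y
          = pd j (pd j (fun w => Real.exp (1 / 2 * u w))) y :=
        pd_congr hΩ (fun z hz => pd_congr hΩ sqrt_eq hz j) hy j
      simp only [second, pd_pd_exp_half hΩ hu2 hy, sqrt_eq y hy]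
      rw [← Finset.mul_sum, mul_div_cancel_left₀ _ (Real.exp_ne_zero _)]
  rw [pd_congr hΩ quotient hx, pd_sum fun j _ =>
    (((du' j).fun_mul (du' j)).const_mul _).fun_add ((du'' j j).const_mul _), Finset.mul_sum]
  refine Finset.sum_congr rfl fun j _ => ?_
  rw [lhs, pd_add (((du' j).fun_mul (du' j)).const_mul _) ((du'' j j).const_mul _),
    pd_const_mul ((du' j).fun_mul (du' j)), pd_const_mul (du'' j j), pd_mul (du' j) (du' j)]
  ring
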